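/- Classical Tsen theorem (hypersurface form): let C be a smooth projective curve over ℂ and let F be a homogeneous polynomial of degree k in N+1 variables with coefficients in the function field ℂ(C). If k ≤ N, then F has a nontrivial zero with coordinates in ℂ(C). -/

import Mathlib

namespace MvPolynomial

/-- The closed points of affine space over an algebraically closed field all have height equal
to the dimension. -/
lemma card_le_height_vanishingIdeal_singleton {k σ : Type*} [Field k] [IsAlgClosed k] [Finite σ]
    (x : σ → k) : (Nat.card σ : ℕ∞) ≤ (vanishingIdeal k {x}).height := by
  have hdim : ringKrullDim (MvPolynomial σ k) ≤ ((vanishingIdeal k {x}).height : WithBot ℕ∞) := by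
    rw [ringKrullDim_le_iff_isMaximal_height_le]
    intro M hM
    obtain ⟨y, rfl⟩ := eq_vanishingIdeal_singleton_of_isMaximal k hM
    let shift (z : σ → k) : MvPolynomial σ k →ₐ[k] MvPolynomial σ k := aeval fun i ↦ X i + C (z i)
    let e : MvPolynomial σ k ≃ₐ[k] MvPolynomial σ k :=
      .ofAlgHom (shift (x - y)) (shift (y - x))
        (by ext i : 1; simp [shift, add_assoc]) (by ext i : 1; simp [shift, add_assoc])
    have hcomap : (vanishingIdeal k {y}).comap (e : MvPolynomial σ k ≃+* MvPolynomial σ k) =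
        vanishingIdeal k {x} := by
      ext p
      have : (aeval y).comp (shift (x - y)) = aeval (R := k) x := by ext i; simp [shift]
      rw [Ideal.mem_comap, mem_vanishingIdeal_singleton_iff, mem_vanishingIdeal_singleton_iff,
        ← this]
      rfl
    rw [← hcomap, RingEquiv.height_comap]
  rw [ringKrullDim_of_isNoetherianRing, ringKrullDim_eq_zero_of_field, zero_add] at hdim
  exact_mod_cast hdim

/-- Fewer forms of positive degree than variables have a nontrivial common zero over an
algebraically closed field. -/
lemma exists_ne_zero_forall_eval_eq_zero {k σ ι : Type*} [Field k] [IsAlgClosed k] [Finite σ]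
    [Finite ι] (hcard : Nat.card ι < Nat.card σ) {m : ℕ} (hm : m ≠ 0) (f : ι → MvPolynomial σ k)
    (hf : ∀ i, (f i).IsHomogeneous m) : ∃ x : σ → k, x ≠ 0 ∧ ∀ i, eval x (f i) = 0 := by
  by_contra! h
  have hzero : zeroLocus k (Ideal.span (Set.range f)) = {0} := by
    ext x
    simp only [zeroLocus_span, Set.forall_mem_range, Set.mem_ofPred_eq, Set.mem_singleton_iff]
    refine ⟨fun hx ↦ ?_, ?_⟩
    · by_contra hx0
      obtain ⟨i, hi⟩ := h x hx0
      exact hi (by simpa [coe_aeval_eq_eval] using hx i)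
    · rintro rfl i
      have : (f i).coeff 0 = 0 := (hf i).coeff_eq_zero (by simpa using hm.symm)
      simpa [coe_aeval_eq_eval, constantCoeff_eq] using this
  have hmin : vanishingIdeal k {(0 : σ → k)} ∈ (Ideal.span (Set.range f)).minimalPrimes := by
    rw [← Ideal.radical_minimalPrimes, ← vanishingIdeal_zeroLocus_eq_radical (K := k), hzero,
      Ideal.minimalPrimes_eq_subsingleton_self]
    rfl
  have hle := (card_le_height_vanishingIdeal_singleton (0 : σ → k)).trans
    (Ideal.height_le_card_of_mem_minimalPrimes_span (Set.finite_range f) hmin)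
  have : (Set.range f).ncard ≤ Nat.card ι := by
    rw [← Set.image_univ, ← Set.ncard_univ]
    exact Set.ncard_image_le
  norm_cast at hle
  omega

/-- A form of positive degree that maps tuples in a subspace `V` into a subspace `W` with
`dim W < |σ| dim V` has a nontrivial zero. -/
lemma exists_ne_zero_eval_eq_zero_of_forall_mem {k K σ κ : Type*} [Field k] [IsAlgClosed k]
    [CommRing K] [Algebra k K] [Finite σ] [Fintype κ] {v : κ → K} (hv : LinearIndependent k v)
    {W : Submodule k K} [FiniteDimensional k W]
    (hcard : Module.finrank k W < Nat.card σ * Nat.card κ) {m : ℕ} (hm : m ≠ 0)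
    {F : MvPolynomial σ K} (hF : F.IsHomogeneous m)
    (hW : ∀ x : σ → K, (∀ i, x i ∈ Submodule.span k (Set.range v)) → eval x F ∈ W) :
    ∃ x : σ → K, x ≠ 0 ∧ eval x F = 0 := by
  obtain ⟨π, hπ⟩ := W.subtype.exists_leftInverse_of_injective W.ker_subtype
  let b := Module.finBasis k W
  let G : MvPolynomial (σ × κ) K := aeval (fun i ↦ ∑ j, C (v j) * X (i, j)) F
  have hG : G.IsHomogeneous m := by
    have := hF.aeval (n := 1) (fun i ↦ ∑ j, C (v j) * X (i, j))
      fun i ↦ IsHomogeneous.sum _ _ _ fun j _ ↦ isHomogeneous_C_mul_X _ (i, j)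
    rwa [one_mul] at this
  let f (l : Fin (Module.finrank k W)) : MvPolynomial (σ × κ) k :=
    ∑ d ∈ G.support, monomial d (b.coord l (π (G.coeff d)))
  have hf (l) : (f l).IsHomogeneous m :=
    IsHomogeneous.sum _ _ _ fun d hd ↦ isHomogeneous_monomial _ (by
      have := hG (mem_support_iff.mp hd)
      rwa [Finsupp.degree_eq_weight_one])
  obtain ⟨a, ha, hfa⟩ := exists_ne_zero_forall_eval_eq_zero
    (by simpa [Nat.card_prod] using hcard) hm f hf
  let x (i : σ) : K := ∑ j, a (i, j) • v j
  have hGx : eval (fun p ↦ algebraMap k K (a p)) G = eval x F := by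
    have : (aeval (R := K) fun p ↦ algebraMap k K (a p)).comp
        (aeval fun i ↦ ∑ j, C (v j) * X (i, j)) = aeval x := by
      ext i
      simp [x, Algebra.smul_def, mul_comm]
    exact DFunLike.congr_fun this F
  have hfG (l) : eval a (f l) = b.coord l (π (eval x F)) := by
    rw [← hGx, eval_eq _ G, map_sum, map_sum, map_sum]
    refine Finset.sum_congr rfl fun d _ ↦ ?_
    have : ∏ i ∈ d.support, algebraMap k K (a i) ^ d i =
        algebraMap k K (∏ i ∈ d.support, a i ^ d i) := by simp
    rw [this, mul_comm, ← Algebra.smul_def, map_smul, map_smul, eval_monomial, smul_eq_mul,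
      mul_comm, Finsupp.prod]
  refine ⟨x, fun hx ↦ ha ?_, ?_⟩
  · ext ⟨i, j⟩
    exact Fintype.linearIndependent_iff.mp hv (fun j ↦ a (i, j)) (congrFun hx i) j
  · have hmem : eval x F ∈ W := hW x fun i ↦ Submodule.sum_mem _ fun j _ ↦
      Submodule.smul_mem _ _ (Submodule.subset_span ⟨j, rfl⟩)
    have hproj : π (eval x F) = ⟨_, hmem⟩ := LinearMap.congr_fun hπ ⟨_, hmem⟩
    have : (⟨_, hmem⟩ : W) = 0 := by
      rw [← hproj]
      exact b.ext_elem fun l ↦ by simpa [hfG] using hfa l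
    exact congrArg Subtype.val this

end MvPolynomial

section

variable (k : Type*) {K : Type*} [Field k] [CommRing K] [Algebra k K]

/-- The values at `t` of the polynomials of degree at most `s`. -/
def degreeLESpan (t : K) (s : ℕ) : Submodule k K :=
  Submodule.span k (Set.range fun i : Fin (s + 1) ↦ t ^ (i : ℕ))

variable {k}

lemma pow_mem_degreeLESpan (t : K) {i s : ℕ} (h : i ≤ s) : t ^ i ∈ degreeLESpan k t s :=
  Submodule.subset_span ⟨⟨i, Nat.lt_succ_of_le h⟩, rfl⟩

lemma aeval_mem_degreeLESpan (t : K) (p : Polynomial k) :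
    Polynomial.aeval t p ∈ degreeLESpan k t p.natDegree := by
  rw [Polynomial.aeval_eq_sum_range]
  exact Submodule.sum_mem _ fun i hi ↦ Submodule.smul_mem _ _
    (pow_mem_degreeLESpan t (Finset.mem_range_succ_iff.mp hi))

lemma degreeLESpan_mono (t : K) : Monotone (degreeLESpan k t) := fun _ _ h ↦
  Submodule.span_le.mpr <| Set.range_subset_iff.mpr fun i ↦
    pow_mem_degreeLESpan t ((Nat.le_of_lt_succ i.2).trans h)

lemma degreeLESpan_mul_le (t : K) (a b : ℕ) :
    degreeLESpan k t a * degreeLESpan k t b ≤ degreeLESpan k t (a + b) := by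
  rw [degreeLESpan, degreeLESpan, Submodule.span_mul_span, Submodule.span_le]
  rintro _ ⟨_, ⟨i, rfl⟩, _, ⟨j, rfl⟩, rfl⟩
  simp only [← pow_add]
  exact pow_mem_degreeLESpan t (by omega)

lemma degreeLESpan_pow_le (t : K) (a : ℕ) :
    ∀ m, degreeLESpan k t a ^ m ≤ degreeLESpan k t (m * a)
  | 0 => by
    rw [pow_zero, Submodule.one_le]
    exact (pow_zero t) ▸ pow_mem_degreeLESpan t (Nat.zero_le _)
  | m + 1 => by
    rw [pow_succ, Nat.succ_mul]
    exact (mul_le_mul_left (degreeLESpan_pow_le t a m) _).trans (degreeLESpan_mul_le t _ _)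

lemma degreeLESpan_mul_span_range (t : K) (s : ℕ) {ι : Type*} (e : ι → K) :
    degreeLESpan k t s * Submodule.span k (Set.range e) =
      Submodule.span k (Set.range fun p : Fin (s + 1) × ι ↦ t ^ (p.1 : ℕ) * e p.2) := by
  rw [degreeLESpan, Submodule.span_mul_span]
  congr 1
  ext z
  simp [Set.mem_mul]

/-- The value of a form of degree `m` on a subspace `V` lies in the span of the coefficients times
the `m`-th power of `V`. -/
lemma MvPolynomial.IsHomogeneous.eval_mem_span_coeffs_mul_pow {σ : Type*} {F : MvPolynomial σ K}
    {m : ℕ} (hF : F.IsHomogeneous m) {V : Submodule k K} {x : σ → K} (hx : ∀ i, x i ∈ V) :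
    eval x F ∈ Submodule.span k (F.coeffs : Set K) * V ^ m := by
  rw [eval_eq]
  refine Submodule.sum_mem _ fun d hd ↦ Submodule.mul_mem_mul
    (Submodule.subset_span (coeff_mem_coeffs d (mem_support_iff.mp hd))) ?_
  rw [hF.degree_eq_sum_deg_support hd]
  induction d.support using Finset.cons_induction with
  | empty => simpa using Submodule.one_le.mp (le_refl (1 : Submodule k K))
  | cons i s hi ih =>
    rw [Finset.prod_cons, Finset.sum_cons, pow_add]
    exact Submodule.mul_mem_mul (Submodule.pow_mem_pow _ (hx i) _) ih

end

section

variable {k K ι : Type*} [Field k] [Field K] [Algebra k K] [Algebra (RatFunc k) K]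
    [IsScalarTower k (RatFunc k) K]

/-- A finitely generated `k`-subspace of a finite extension of `k(t)` has a common denominator
in `k[t]` with respect to a basis. -/
lemma exists_forall_mul_mem_degreeLESpan_mul_span [Finite ι] (e : Module.Basis ι (RatFunc k) K)
    {M : Submodule k K} (hM : M.FG) : ∃ q : K, q ≠ 0 ∧ ∃ r, ∀ z ∈ M,
      q * z ∈ degreeLESpan k (algebraMap (RatFunc k) K RatFunc.X) r *
        Submodule.span k (Set.range e) := by
  set t := algebraMap (RatFunc k) K RatFunc.X with ht
  have hpoly (p : Polynomial k) :
      algebraMap (RatFunc k) K (algebraMap _ _ p) = Polynomial.aeval t p := by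
    rw [ht, Polynomial.aeval_algebraMap_apply, RatFunc.aeval_X_left_eq_algebraMap]
  have hne {p : Polynomial k} (hp : p ≠ 0) : Polynomial.aeval t p ≠ 0 := by
    rw [← hpoly]; simpa using hp
  obtain ⟨S, rfl⟩ := hM
  obtain ⟨⟨b, hb⟩, hbS⟩ := IsLocalization.exist_integer_multiples_of_finite
    (nonZeroDivisors (Polynomial k)) fun p : S × ι ↦ e.repr p.1 p.2
  choose c hc using hbS
  cases nonempty_fintype ι
  refine ⟨_, hne (nonZeroDivisors.ne_zero hb), Finset.univ.sup fun p ↦ (c p).natDegree, ?_⟩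
  suffices Submodule.span k (S : Set K) ≤ (degreeLESpan k t _ *
      Submodule.span k (Set.range e)).comap (LinearMap.mulLeft k (Polynomial.aeval t b)) from this
  rw [Submodule.span_le]
  intro z hz
  have hsum : Polynomial.aeval t b * z = ∑ i, Polynomial.aeval t (c (⟨z, hz⟩, i)) * e i := by
    conv_lhs => rw [← e.sum_repr z]
    rw [Finset.mul_sum]
    refine Finset.sum_congr rfl fun i _ ↦ ?_
    rw [← hpoly, ← hpoly, hc, Algebra.smul_def, Algebra.smul_def, map_mul, mul_assoc]
  rw [SetLike.mem_coe, Submodule.mem_comap, LinearMap.mulLeft_apply, hsum]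
  exact Submodule.sum_mem _ fun i _ ↦ Submodule.mul_mem_mul
    (degreeLESpan_mono t (Finset.le_sup (f := fun p ↦ (c p).natDegree) (Finset.mem_univ _))
      (aeval_mem_degreeLESpan t _)) (Submodule.subset_span ⟨i, rfl⟩)

/-- Tsen's theorem over an algebraically closed field: a form of positive degree `m` in more than
`m` variables over a finite extension of `k(t)` has a nontrivial zero. -/
theorem MvPolynomial.IsHomogeneous.exists_ne_zero_eval_eq_zero [IsAlgClosed k]
    [FiniteDimensional (RatFunc k) K] {σ : Type*} [Finite σ] {F : MvPolynomial σ K} {m : ℕ}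
    (hF : F.IsHomogeneous m) (hm : m ≠ 0) (hcard : m < Nat.card σ) :
    ∃ x : σ → K, x ≠ 0 ∧ eval x F = 0 := by
  set t := algebraMap (RatFunc k) K RatFunc.X
  let e := Module.finBasis (RatFunc k) K
  set d := Module.finrank (RatFunc k) K
  have hd : 0 < d := Module.finrank_pos
  let E := Submodule.span k (Set.range e)
  have hE : E.FG := Submodule.fg_span (Set.finite_range e)
  obtain ⟨q, hq, r, hr⟩ := exists_forall_mul_mem_degreeLESpan_mul_span e
    ((Submodule.fg_span F.coeffs.finite_toSet : (Submodule.span k _).FG).mul (hE.pow m))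
  let v (p : Fin (r + 1) × Fin d) : K := t ^ (p.1 : ℕ) * e p.2
  let W := degreeLESpan k t (m * r + r) * E
  have hWspan := degreeLESpan_mul_span_range (k := k) t (m * r + r) e
  have hv : LinearIndependent k v := by
    have hX : LinearIndependent k fun i : Fin (r + 1) ↦ (RatFunc.X : RatFunc k) ^ (i : ℕ) := by
      have hpow := ((Polynomial.basisMonomials k).linearIndependent.map'
        (IsScalarTower.toAlgHom k (Polynomial k) (RatFunc k)).toLinearMap
        (LinearMap.ker_eq_bot.mpr (IsFractionRing.injective _ _))).comp _
          (Fin.val_injective (n := r + 1))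
      have heq : (fun i : Fin (r + 1) ↦ (RatFunc.X : RatFunc k) ^ (i : ℕ)) =
          ((IsScalarTower.toAlgHom k (Polynomial k) (RatFunc k)).toLinearMap ∘
            Polynomial.basisMonomials k) ∘ Fin.val := by
        ext i : 1
        simp [← Polynomial.X_pow_eq_monomial]
      rw [heq]
      exact hpow
    convert linearIndependent_smul hX e.linearIndependent using 2 with p
    simp [v, t, Algebra.smul_def]
  have : FiniteDimensional k W :=
    .of_fg (.mul (Submodule.fg_span (Set.finite_range _)) hE)
  have hWcard : Module.finrank k W ≤ (m * r + r + 1) * d := by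
    refine (congrArg (fun U : Submodule k K ↦ Module.finrank k U) hWspan).trans_le ?_
    simpa [Set.finrank] using finrank_range_le_card (R := k)
      fun p : Fin (m * r + r + 1) × Fin d ↦ t ^ (p.1 : ℕ) * e p.2
  have hWmem (x : σ → K) (hx : ∀ i, x i ∈ Submodule.span k (Set.range v)) :
      eval x (C q * F) ∈ W := by
    have hxV (i) : x i ∈ degreeLESpan k t r * E := by
      rw [degreeLESpan_mul_span_range]
      exact hx i
    have hmem := hF.eval_mem_span_coeffs_mul_pow hxV
    rw [mul_pow, mul_left_comm] at hmem
    rw [map_mul, eval_C]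
    have hle : degreeLESpan k t r ^ m * (Submodule.span k (F.coeffs : Set K) * E ^ m) ≤
        W.comap (LinearMap.mulLeft k q) := by
      rw [Submodule.mul_le]
      intro y hy z hz
      have := Submodule.mul_mem_mul (degreeLESpan_pow_le t r m hy) (hr z hz)
      rw [← mul_assoc] at this
      rw [Submodule.mem_comap, LinearMap.mulLeft_apply, mul_left_comm]
      exact mul_le_mul_left (degreeLESpan_mul_le t _ _) _ this
    exact hle hmem
  have hlt : m * r + r + 1 < Nat.card σ * (r + 1) := calc
    m * r + r + 1 < (m + 1) * (r + 1) := by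
      rw [add_one_mul, mul_add_one]
      omega
    _ ≤ _ := Nat.mul_le_mul_right _ hcard
  obtain ⟨x, hx, hFx⟩ := exists_ne_zero_eval_eq_zero_of_forall_mem hv
    (hWcard.trans_lt (by
      simpa [Nat.card_prod, mul_assoc] using Nat.mul_lt_mul_of_pos_right hlt hd))
    hm (hF.C_mul q) hWmem
  exact ⟨x, hx, by simpa [hq] using hFx⟩

end

/-- classical Tsen theorem, hypersurface form: the function field `K = ℂ(C)`
of a smooth projective complex curve (a finite extension of `ℂ(t) = RatFunc ℂ`) is a C₁
field: every homogeneous form `F` of degree `k ≥ 1` in `N + 1` variables with `k ≤ N` has a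
nontrivial zero with coordinates in `K`. -/
theorem stmt_1 (K : Type*) [Field K] [Algebra ℂ K] [Algebra (RatFunc ℂ) K]
    [IsScalarTower ℂ (RatFunc ℂ) K] [FiniteDimensional (RatFunc ℂ) K]
    (N k : ℕ) (hk : 0 < k) (hkN : k ≤ N)
    (F : MvPolynomial (Fin (N + 1)) K) (hF : F.IsHomogeneous k) :
    ∃ x : Fin (N + 1) → K, x ≠ 0 ∧ MvPolynomial.eval x F = 0 := by
  exact hF.exists_ne_zero_eval_eq_zero (k := ℂ) hk.ne' (by simpa using Nat.lt_succ_of_le hkN)
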